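/- (Theorem B) Let n ≥ 3 and let f be a positive continuous probability density on (0,∞) (with f = 0 on (−∞,0]). Let B_{n−2} = {(t_1,…,t_{n−2}) ∈ ℝ^{n−2} : −1 ≤ t_1 ≤ −1/(n−1), and for k = 2,…,n−2, max{((n−k+2)/(n−k))^{1/2} t_{k−1}, −g_{k−1}^{1/2}} ≤ t_k ≤ −g_{k−1}^{1/2}/(n−k)}, where g_k(t_1,…,t_k) = 1 − t_1² − ⋯ − t_k². Let G be a probability measure on B_{n−2}, and let σ_1,…,σ_n be continuous functions on B_{n−2} with ∑_{j=1}^n σ_j(t) = 0 and 0 < ∑_{j=1}^n σ_j(t)² < ∞ for all t ∈ B_{n−2}. If there are constants c̃ > 0 and s_0 > 0 such that ∫_{B_{n−2}} ∏_{j=1}^n f(x(s σ_j(t) + 1)) dG(t) = c̃ (f(x))^n ∫_{B_{n−2}} ∏_{j=1}^n f(s σ_j(t) + 1) dG(t) for all x > 0 and all s ∈ [0, s_0), then f is a gamma density, i.e. f(x) = x^{a−1}e^{−x/b}/(Γ(a)b^a) for x > 0, for some a > 0 and b > 0. -/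

import Mathlib

open MeasureTheory ProbabilityTheory Real

/-- `gfun t k = 1 - t₁² - ⋯ - t_k²` (the first `k` coordinates of `t`). -/
noncomputable def gfun {m : ℕ} (t : Fin m → ℝ) (k : ℕ) : ℝ :=
  1 - ∑ j : Fin m, if (j : ℕ) < k then (t j) ^ 2 else 0

/-- The set `B_{n-2} ⊂ ℝ^{n-2}`. Coordinate `i : Fin (n-2)` corresponds to `t_{i+1}`
in the paper's (1-based) notation. -/
noncomputable def Bset (n : ℕ) : Set (Fin (n - 2) → ℝ) :=
  {t | ∀ i : Fin (n - 2),
    ((i : ℕ) = 0 → -1 ≤ t i ∧ t i ≤ -1 / ((n : ℝ) - 1)) ∧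
    (1 ≤ (i : ℕ) →
      max (Real.sqrt (((n : ℝ) - ((i : ℕ) + 1) + 2) / ((n : ℝ) - ((i : ℕ) + 1))) *
            t ⟨(i : ℕ) - 1, lt_of_le_of_lt (Nat.sub_le _ _) i.isLt⟩)
          (-(Real.sqrt (gfun t (i : ℕ)))) ≤ t i ∧
      t i ≤ -(Real.sqrt (gfun t (i : ℕ))) / ((n : ℝ) - ((i : ℕ) + 1)))}

open Set Filter Topology

/-- A continuous function on `(0, ∞)` that is not convex differs from a linear function by a
function with an interior maximum on some compact interval. -/
theorem exists_interior_max_of_not_convexOn {w : ℝ → ℝ} (hw : ContinuousOn w (Ioi 0))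
    (h : ¬ ConvexOn ℝ (Ioi 0) w) :
    ∃ p q β x₀ : ℝ, 0 < p ∧ p < x₀ ∧ x₀ < q ∧
      ∀ y ∈ Icc p q, w y - β * y ≤ w x₀ - β * x₀ := by
  have h' : ∃ p ∈ Ioi (0 : ℝ), ∃ q ∈ Ioi (0 : ℝ), p < q ∧ ∃ a b : ℝ, 0 < a ∧ 0 < b ∧ a + b = 1 ∧
      a * w p + b * w q < w (a * p + b * q) := by
    by_contra! hcon
    refine h (LinearOrder.convexOn_of_lt (convex_Ioi 0) ?_)
    intro x hx y hy hxy a b ha hb hab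
    simpa using hcon x hx y hy hxy a b ha hb hab
  obtain ⟨p, hp, q, hq, hpq, a, b, ha, hb, hab, hlt⟩ := h'
  rw [mem_Ioi] at hp hq
  obtain ⟨β, hβ⟩ : ∃ β : ℝ, β * (q - p) = w q - w p :=
    ⟨(w q - w p) / (q - p), div_mul_cancel₀ _ (by linarith)⟩
  have hcont : ContinuousOn (fun y => w y - β * y) (Icc p q) :=
    (hw.mono fun y hy => lt_of_lt_of_le hp hy.1).sub (by fun_prop)
  obtain ⟨x₀, hx₀, hmax⟩ := isCompact_Icc.exists_isMaxOn ⟨p, left_mem_Icc.2 hpq.le⟩ hcont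
  have hm : a * p + b * q ∈ Icc p q := by
    obtain rfl : a = 1 - b := by linarith
    constructor <;> nlinarith
  have hmid : w (a * p + b * q) - β * (a * p + b * q) ≤ w x₀ - β * x₀ := hmax hm
  obtain rfl : a = 1 - b := by linarith
  have hp' : w p - β * p < w x₀ - β * x₀ := by nlinarith
  have hq' : w q - β * q < w x₀ - β * x₀ := by nlinarith
  refine ⟨p, q, β, x₀, hp, lt_of_le_of_ne hx₀.1 ?_, lt_of_le_of_ne hx₀.2 ?_, fun y hy => hmax hy⟩
  · rintro rfl
    exact lt_irrefl _ hp'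
  · rintro rfl
    exact lt_irrefl _ hq'

/-- A function on `(0, ∞)` that is both convex and concave is affine. -/
theorem exists_affine_of_convexOn_of_concaveOn {u : ℝ → ℝ} (h₁ : ConvexOn ℝ (Ioi 0) u)
    (h₂ : ConcaveOn ℝ (Ioi 0) u) : ∃ β γ : ℝ, ∀ x, 0 < x → u x = β * x + γ := by
  have key : ∀ p m q : ℝ, 0 < p → p < m → m < q →
      (q - p) * u m = (q - m) * u p + (m - p) * u q := by
    intro p m q hp hpm hmq
    have hqp : 0 < q - p := by linarith
    have ha : 0 ≤ (q - m) / (q - p) := div_nonneg (by linarith) hqp.le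
    have hb : 0 ≤ (m - p) / (q - p) := div_nonneg (by linarith) hqp.le
    have hab : (q - m) / (q - p) + (m - p) / (q - p) = 1 := by field_simp; ring
    have hmem : (q - m) / (q - p) * p + (m - p) / (q - p) * q = m := by field_simp; ring
    have hle := h₁.2 (mem_Ioi.2 hp) (mem_Ioi.2 (by linarith : 0 < q)) ha hb hab
    have hge := h₂.2 (mem_Ioi.2 hp) (mem_Ioi.2 (by linarith : 0 < q)) ha hb hab
    simp only [smul_eq_mul, hmem] at hle hge
    have heq := le_antisymm hle hge
    rw [heq]
    field_simp
  refine ⟨u 2 - u 1, 2 * u 1 - u 2, fun x hx => ?_⟩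
  rcases lt_trichotomy x 1 with h | rfl | h
  · linarith [key x 1 2 hx h (by norm_num)]
  · ring
  rcases lt_trichotomy x 2 with h' | rfl | h'
  · linarith [key 1 x 2 one_pos h h']
  · ring
  · linarith [key 1 2 x one_pos (by norm_num) h']

/-- A probability density on `(0, ∞)` proportional to `x ^ (-L) * exp (β * x)` is a gamma
density. -/
theorem exists_gamma_density_of_log_eq {f : ℝ → ℝ} (hf_pos : ∀ x, 0 < x → 0 < f x)
    (hf_zero : ∀ x, x ≤ 0 → f x = 0) (hf_int : ∫ x, f x = 1) {L β γ : ℝ}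
    (hlog : ∀ x, 0 < x → log (f x) + L * log x = β * x + γ) :
    ∃ a b : ℝ, 0 < a ∧ 0 < b ∧
      ∀ x : ℝ, 0 < x → f x = x ^ (a - 1) * exp (-x / b) / (Gamma a * b ^ a) := by
  have hform : ∀ x, 0 < x → f x = exp γ * (x ^ (-L) * exp (β * x)) := by
    intro x hx
    rw [rpow_def_of_pos hx, ← exp_add, ← exp_add, ← exp_log (hf_pos x hx)]
    congr 1
    linarith [hlog x hx]
  have hint : Integrable f := by
    by_contra h
    rw [integral_undef h] at hf_int
    exact zero_ne_one hf_int
  have hcont : ContinuousOn (fun x : ℝ => x ^ (-L)) (Ioi 0) := fun x hx =>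
    (continuousAt_rpow_const x (-L) (Or.inl (ne_of_gt hx))).continuousWithinAt
  have hL : L < 1 := by
    have h₁ : IntegrableOn (fun x : ℝ => x ^ (-L)) (Ioo 0 1) := by
      refine Integrable.mono' (hint.integrableOn.const_mul (exp (|β| - γ)))
        ((hcont.mono Ioo_subset_Ioi_self).aestronglyMeasurable measurableSet_Ioo) ?_
      filter_upwards [ae_restrict_mem measurableSet_Ioo] with x hx
      have hx0 : 0 < x ^ (-L) := rpow_pos_of_pos hx.1 _
      rw [norm_of_nonneg hx0.le, hform x hx.1]
      have : 1 ≤ exp (|β| - γ) * (exp γ * exp (β * x)) := by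
        rw [← exp_add, ← exp_add]
        apply one_le_exp
        have := mul_le_mul_of_nonneg_left hx.2.le (abs_nonneg β)
        have := mul_le_mul_of_nonneg_right (neg_abs_le β) hx.1.le
        linarith
      nlinarith
    rw [intervalIntegral.integrableOn_Ioo_rpow_iff one_pos] at h₁
    linarith
  have hβ : β < 0 := by
    by_contra! hβ
    have h₁ : IntegrableOn (fun x : ℝ => x ^ (-L)) (Ioi 1) := by
      refine Integrable.mono' (hint.integrableOn.const_mul (exp (-γ)))
        ((hcont.mono (Ioi_subset_Ioi zero_le_one)).aestronglyMeasurable measurableSet_Ioi) ?_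
      filter_upwards [ae_restrict_mem measurableSet_Ioi] with x hx
      have hx' : 0 < x := one_pos.trans hx
      have hx0 : 0 < x ^ (-L) := rpow_pos_of_pos hx' _
      rw [norm_of_nonneg hx0.le, hform x hx', ← mul_assoc, ← exp_add, neg_add_cancel, exp_zero,
        one_mul]
      exact le_mul_of_one_le_right hx0.le (one_le_exp (by positivity))
    rw [integrableOn_Ioi_rpow_iff one_pos] at h₁
    linarith
  have ha : 0 < 1 - L := by linarith
  have hb : 0 < 1 / (-β) := one_div_pos.2 (by linarith)
  have htot : exp γ * ((1 / (-β)) ^ (1 - L) * Gamma (1 - L)) = 1 := by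
    rw [← integral_rpow_mul_exp_neg_mul_Ioi ha (by linarith : 0 < -β), ← integral_const_mul,
      ← hf_int, ← setIntegral_eq_integral_of_forall_compl_eq_zero (s := Ioi 0)
        (fun x hx => hf_zero x (not_lt.1 hx))]
    refine setIntegral_congr_fun measurableSet_Ioi fun x hx => ?_
    rw [hform x hx]
    simp
  refine ⟨1 - L, 1 / (-β), ha, hb, fun x hx => ?_⟩
  have hΓ := Gamma_pos_of_pos ha
  have hbp := rpow_pos_of_pos hb (1 - L)
  rw [hform x hx, eq_div_iff (by positivity), show -x / (1 / (-β)) = β * x by field_simp,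
    show 1 - L - 1 = -L by ring]
  linear_combination (x ^ (-L) * exp (β * x)) * htot

theorem continuous_gfun {m : ℕ} (k : ℕ) : Continuous fun t : Fin m → ℝ => gfun t k := by
  unfold gfun
  refine continuous_const.sub (continuous_finsetSum _ fun j _ => ?_)
  split_ifs <;> fun_prop

theorem isCompact_Bset {n : ℕ} (hn : 3 ≤ n) : IsCompact (Bset n) := by
  have hclosed : IsClosed (Bset n) := by
    unfold Bset
    simp only [ofPred_forall, ofPred_and]
    refine isClosed_iInter fun i => IsClosed.inter ?_ ?_
    · refine isClosed_iInter fun _ => IsClosed.inter ?_ ?_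
      · exact isClosed_le (by fun_prop) (by fun_prop)
      · exact isClosed_le (by fun_prop) (by fun_prop)
    · have hg := (continuous_gfun (m := n - 2) (i : ℕ)).sqrt
      refine isClosed_iInter fun _ => IsClosed.inter ?_ ?_
      · exact isClosed_le (by fun_prop) (by fun_prop)
      · exact isClosed_le (by fun_prop) (by fun_prop)
  refine (isCompact_Icc (a := fun _ => (-1 : ℝ)) (b := fun _ => 0)).of_isClosed_subset hclosed ?_
  intro t ht
  have key : ∀ i, -1 ≤ t i ∧ t i ≤ 0 := by
    intro i
    have hn' : (3 : ℝ) ≤ n := by exact_mod_cast hn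
    rcases Nat.eq_zero_or_pos (i : ℕ) with h | h
    · obtain ⟨h₁, h₂⟩ := (ht i).1 h
      exact ⟨h₁, h₂.trans (div_nonpos_of_nonpos_of_nonneg (by norm_num) (by linarith))⟩
    · obtain ⟨h₁, h₂⟩ := (ht i).2 h
      have hi : ((i : ℕ) : ℝ) + 1 ≤ n := by
        have := i.isLt
        exact_mod_cast (by omega : (i : ℕ) + 1 ≤ n)
      have hg : gfun t i ≤ 1 := by
        unfold gfun
        have : 0 ≤ ∑ j : Fin (n - 2), if (j : ℕ) < i then (t j) ^ 2 else 0 :=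
          Finset.sum_nonneg fun j _ => by split_ifs <;> positivity
        linarith
      have hs : sqrt (gfun t i) ≤ 1 := sqrt_le_one.2 hg
      exact ⟨by linarith [(le_max_right _ _).trans h₁], h₂.trans
        (div_nonpos_of_nonpos_of_nonneg (neg_nonpos.2 (sqrt_nonneg _)) (by linarith))⟩
  exact ⟨fun i => (key i).1, fun i => (key i).2⟩

theorem prod_le_pow_mul_exp {n : ℕ} {f : ℝ → ℝ} (hf_pos : ∀ x, 0 < x → 0 < f x) {u : Fin n → ℝ}
    (hu : ∀ j, 0 < u j) (hsum : ∑ j, u j = n) {x A β : ℝ} (hx : 0 < x)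
    (h : ∀ j, log (f (x * u j)) + A * log (x * u j) - β * (x * u j)
      ≤ log (f x) + A * log x - β * x) :
    ∏ j, f (x * u j) ≤ f x ^ n * exp (-A * ∑ j, log (u j)) := by
  have hle := Finset.sum_le_sum fun j (_ : j ∈ Finset.univ) => h j
  simp only [log_mul hx.ne' (hu _).ne', mul_add, Finset.sum_add_distrib, Finset.sum_sub_distrib,
    Finset.sum_const, Finset.card_univ, Fintype.card_fin, nsmul_eq_mul, ← Finset.mul_sum, hsum]
    at hle
  rw [← exp_log (Finset.prod_pos fun j _ => hf_pos _ (mul_pos hx (hu j))),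
    log_prod fun j _ => (hf_pos _ (mul_pos hx (hu j))).ne', ← exp_log (pow_pos (hf_pos x hx) n),
    log_pow, ← exp_add]
  apply exp_le_exp.2
  linarith

theorem pow_mul_exp_le_prod {n : ℕ} {f : ℝ → ℝ} (hf_pos : ∀ x, 0 < x → 0 < f x) {u : Fin n → ℝ}
    (hu : ∀ j, 0 < u j) (hsum : ∑ j, u j = n) {x A β : ℝ} (hx : 0 < x)
    (h : ∀ j, log (f x) + A * log x - β * x
      ≤ log (f (x * u j)) + A * log (x * u j) - β * (x * u j)) :
    f x ^ n * exp (-A * ∑ j, log (u j)) ≤ ∏ j, f (x * u j) := by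
  have hle := Finset.sum_le_sum fun j (_ : j ∈ Finset.univ) => h j
  simp only [log_mul hx.ne' (hu _).ne', mul_add, Finset.sum_add_distrib, Finset.sum_sub_distrib,
    Finset.sum_const, Finset.card_univ, Fintype.card_fin, nsmul_eq_mul, ← Finset.mul_sum, hsum]
    at hle
  rw [← exp_log (Finset.prod_pos fun j _ => hf_pos _ (mul_pos hx (hu j))),
    log_prod fun j _ => (hf_pos _ (mul_pos hx (hu j))).ne', ← exp_log (pow_pos (hf_pos x hx) n),
    log_pow, ← exp_add]
  apply exp_le_exp.2
  linarith

theorem sum_log_neg {n : ℕ} {v : Fin n → ℝ} (hv : ∀ j, 0 < v j + 1) (hsum : ∑ j, v j = 0)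
    (hsq : 0 < ∑ j, v j ^ 2) : ∑ j, log (v j + 1) < 0 := by
  rw [← hsum]
  obtain ⟨j, -, hj⟩ := Finset.exists_ne_zero_of_sum_ne_zero hsq.ne'
  refine Finset.sum_lt_sum (fun i _ => by linarith [log_le_sub_one_of_pos (hv i)])
    ⟨j, Finset.mem_univ j, ?_⟩
  have : v j + 1 ≠ 1 := fun h => hj (by rw [add_eq_right.1 h]; simp)
  linarith [log_lt_sub_one_of_pos (hv j) this]

/-- For a compact family of scalings, small perturbations of `x₀` stay in a given
neighbourhood of `x₀`. -/
theorem eventually_forall_mul_mem {X ι : Type*} [TopologicalSpace X] [Finite ι] {K : Set X}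
    (hK : IsCompact K) {σ : ι → X → ℝ} (hσ : ∀ j, ContinuousOn (σ j) K) {x₀ : ℝ} {U : Set ℝ}
    (hU : U ∈ 𝓝 x₀) : ∀ᶠ s in 𝓝[>] (0 : ℝ), ∀ t ∈ K, ∀ j, x₀ * (s * σ j t + 1) ∈ U := by
  have hb : ∀ j, ∃ C, ∀ t ∈ K, |σ j t| ≤ C := fun j => hK.exists_bound_of_continuousOn (hσ j)
  choose C hC using hb
  obtain ⟨ε, hε, hball⟩ := Metric.mem_nhds_iff.1 hU
  suffices h : ∀ᶠ s in 𝓝[>] (0 : ℝ), ∀ j, ∀ t ∈ K, x₀ * (s * σ j t + 1) ∈ U from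
    h.mono fun s hs t ht j => hs j t ht
  rw [eventually_all]
  intro j
  have hlim : Tendsto (fun s : ℝ => |x₀| * (|s| * C j)) (𝓝[>] 0) (𝓝 0) := by
    have : Continuous fun s : ℝ => |x₀| * (|s| * C j) := by fun_prop
    simpa using (this.tendsto 0).mono_left nhdsWithin_le_nhds
  filter_upwards [hlim.eventually_lt_const hε] with s hs t ht
  apply hball
  rw [Metric.mem_ball, dist_eq, show x₀ * (s * σ j t + 1) - x₀ = x₀ * (s * σ j t) by ring, abs_mul,
    abs_mul]
  refine lt_of_le_of_lt ?_ hs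
  gcongr
  exact hC j t ht

theorem gamma_version_of_anosov_theorem
    (n : ℕ) (hn : 3 ≤ n)
    (f : ℝ → ℝ)
    (hf_pos : ∀ x, 0 < x → 0 < f x)
    (hf_cont : ContinuousOn f (Set.Ioi 0))
    (hf_zero : ∀ x, x ≤ 0 → f x = 0)
    (hf_int : ∫ x, f x = 1)
    (G : Measure (Fin (n - 2) → ℝ)) [IsProbabilityMeasure G]
    (hG : G (Bset n)ᶜ = 0)
    (σ : Fin n → (Fin (n - 2) → ℝ) → ℝ)
    (hσ_cont : ∀ j, ContinuousOn (σ j) (Bset n))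
    (hσ_sum : ∀ t ∈ Bset n, ∑ j, σ j t = 0)
    (hσ_sq : ∀ t ∈ Bset n, 0 < ∑ j, (σ j t) ^ 2)
    (c : ℝ) (hc : 0 < c) (s₀ : ℝ) (hs₀ : 0 < s₀)
    (heq : ∀ x : ℝ, 0 < x → ∀ s : ℝ, 0 ≤ s → s < s₀ →
      ∫ t in Bset n, ∏ j, f (x * (s * σ j t + 1)) ∂G
        = c * (f x) ^ n * ∫ t in Bset n, ∏ j, f (s * σ j t + 1) ∂G) :
    ∃ a b : ℝ, 0 < a ∧ 0 < b ∧
      ∀ x : ℝ, 0 < x →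
        f x = x ^ (a - 1) * Real.exp (-x / b) / (Real.Gamma a * b ^ a) := by
  have hK := isCompact_Bset hn
  set K := Bset n with hKdef
  have hKm : MeasurableSet K := hK.measurableSet
  have hGK : G K ≠ 0 := by
    rw [(prob_compl_eq_zero_iff hKm).1 hG]
    exact one_ne_zero
  set R : ℝ → ℝ := fun s => c * ∫ t in K, ∏ j, f (s * σ j t + 1) ∂G with hR
  set I : ℝ → ℝ → ℝ := fun A s => ∫ t in K, exp (-A * ∑ j, log (s * σ j t + 1)) ∂G with hI
  have hpos : ∀ᶠ s in 𝓝[>] (0 : ℝ), ∀ t ∈ K, ∀ j, 0 < s * σ j t + 1 := by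
    simpa using eventually_forall_mul_mem hK hσ_cont (Ioi_mem_nhds (one_pos (α := ℝ)))
  have hIint : ∀ A s, (∀ t ∈ K, ∀ j, 0 < s * σ j t + 1) →
      IntegrableOn (fun t => exp (-A * ∑ j, log (s * σ j t + 1))) K G := by
    intro A s hs
    refine ContinuousOn.integrableOn_compact hK (ContinuousOn.rexp (continuousOn_const.mul
      (continuousOn_finsetSum _ fun j _ => ContinuousOn.log ?_ fun t ht => (hs t ht j).ne')))
    exact (continuousOn_const.mul (hσ_cont j)).add continuousOn_const
  have hfint : ∀ x s, 0 < x → (∀ t ∈ K, ∀ j, 0 < s * σ j t + 1) →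
      IntegrableOn (fun t => ∏ j, f (x * (s * σ j t + 1))) K G := by
    intro x s hx hs
    refine ContinuousOn.integrableOn_compact hK (continuousOn_finsetProd _ fun j _ =>
      hf_cont.comp ?_ fun t ht => mul_pos hx (hs t ht j))
    exact continuousOn_const.mul ((continuousOn_const.mul (hσ_cont j)).add continuousOn_const)
  have hsum : ∀ s : ℝ, ∀ t ∈ K, ∑ j, (s * σ j t + 1) = n := by
    intro s t ht
    rw [Finset.sum_add_distrib, ← Finset.mul_sum, hσ_sum t ht]
    simp
  have hIlt : ∀ A A', A < A' → ∀ᶠ s in 𝓝[>] (0 : ℝ), I A s < I A' s := by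
    intro A A' hA
    filter_upwards [hpos, self_mem_nhdsWithin] with s hs hs0
    rw [mem_Ioi] at hs0
    have hlt : ∀ t ∈ K, exp (-A * ∑ j, log (s * σ j t + 1))
        < exp (-A' * ∑ j, log (s * σ j t + 1)) := by
      intro t ht
      have hneg := sum_log_neg (hs t ht) (by rw [← Finset.mul_sum, hσ_sum t ht, mul_zero])
        (by simp only [mul_pow, ← Finset.mul_sum]; exact mul_pos (pow_pos hs0 2) (hσ_sq t ht))
      exact exp_lt_exp.2 (by nlinarith)
    rw [← sub_pos, ← integral_sub (hIint A' s hs) (hIint A s hs)]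
    refine (setIntegral_pos_iff_support_of_nonneg_ae
      ((ae_restrict_mem hKm).mono fun t ht => sub_nonneg.2 (hlt t ht).le)
      ((hIint A' s hs).sub (hIint A s hs))).2 (pos_iff_ne_zero.2 fun h0 => hGK ?_)
    exact measure_mono_null (fun t ht => mem_inter (sub_pos.2 (hlt t ht)).ne' ht) h0
  have hsmall : ∀ᶠ s in 𝓝[>] (0 : ℝ), 0 < s ∧ s < s₀ :=
    Ioo_mem_nhdsGT hs₀
  have hRform : ∀ x s, 0 < x → 0 < s → s < s₀ →
      ∫ t in K, ∏ j, f (x * (s * σ j t + 1)) ∂G = f x ^ n * R s := by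
    intro x s hx hs hs'
    rw [heq x hx s hs.le hs']
    ring
  have hwcont : ∀ A, ContinuousOn (fun x => log (f x) + A * log x) (Ioi 0) := fun A =>
    (hf_cont.log fun x hx => (hf_pos x hx).ne').add
      (continuousOn_const.mul (continuousOn_log.mono fun x hx => (ne_of_gt hx)))
  have hconvex : ∀ A, (∃ᶠ s in 𝓝[>] (0 : ℝ), I A s < R s) →
      ConvexOn ℝ (Ioi 0) fun x => log (f x) + A * log x := by
    intro A hA
    by_contra hcon
    obtain ⟨p, q, β, x, hp, hpx, hxq, hmax⟩ :=
      exists_interior_max_of_not_convexOn (hwcont A) hcon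
    have hx : 0 < x := hp.trans hpx
    refine hA ?_
    filter_upwards [hpos, hsmall, eventually_forall_mul_mem hK hσ_cont (Icc_mem_nhds hpx hxq)]
      with s hs hs0 hmem
    rw [not_lt]
    refine le_of_mul_le_mul_left ?_ (pow_pos (hf_pos x hx) n)
    rw [← hRform x s hx hs0.1 hs0.2, hI, ← integral_const_mul]
    exact setIntegral_mono_on (hfint x s hx hs) ((hIint A s hs).const_mul _) hKm fun t ht =>
      prod_le_pow_mul_exp hf_pos (hs t ht) (hsum s t ht) hx fun j => hmax _ (hmem t ht j)
  have hconcave : ∀ A, (∃ᶠ s in 𝓝[>] (0 : ℝ), R s < I A s) →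
      ConcaveOn ℝ (Ioi 0) fun x => log (f x) + A * log x := by
    intro A hA
    by_contra hcon
    rw [← neg_convexOn_iff] at hcon
    obtain ⟨p, q, β, x, hp, hpx, hxq, hmax⟩ :=
      exists_interior_max_of_not_convexOn (hwcont A).neg hcon
    have hx : 0 < x := hp.trans hpx
    refine hA ?_
    filter_upwards [hpos, hsmall, eventually_forall_mul_mem hK hσ_cont (Icc_mem_nhds hpx hxq)]
      with s hs hs0 hmem
    rw [not_lt]
    refine le_of_mul_le_mul_left ?_ (pow_pos (hf_pos x hx) n)
    rw [← hRform x s hx hs0.1 hs0.2, hI, ← integral_const_mul]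
    refine setIntegral_mono_on ((hIint A s hs).const_mul _) (hfint x s hx hs) hKm fun t ht =>
      pow_mul_exp_le_prod (β := -β) hf_pos (hs t ht) (hsum s t ht) hx fun j => ?_
    have := hmax _ (hmem t ht j)
    simp only [Pi.neg_apply] at this
    linarith
  have hdich : ∀ A A', A < A' → ConvexOn ℝ (Ioi 0) (fun x => log (f x) + A * log x) ∨
      ConcaveOn ℝ (Ioi 0) fun x => log (f x) + A' * log x := by
    intro A A' hAA
    by_cases h : ∃ᶠ s in 𝓝[>] (0 : ℝ), I A s < R s
    · exact Or.inl (hconvex A h)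
    · rw [not_frequently] at h
      refine Or.inr (hconcave A' (Eventually.frequently ?_))
      filter_upwards [h, hIlt A A' hAA] with s hs hs'
      exact (not_lt.1 hs).trans_lt hs'
  have hκ : 0 < 2 * log 2 - log 3 := by
    have : log 3 < log (2 ^ 2) := log_lt_log (by norm_num) (by norm_num)
    rw [log_pow] at this
    push_cast at this
    linarith
  obtain ⟨L, hL⟩ : ∃ L : ℝ, L * (2 * log 2 - log 3) = log (f 1) + log (f 3) - 2 * log (f 2) :=
    ⟨_, div_mul_cancel₀ _ hκ.ne'⟩
  have hmid : (1 / 2 : ℝ) * 1 + 1 / 2 * 3 = 2 := by norm_num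
  have hupper : ∀ A, ConvexOn ℝ (Ioi 0) (fun x => log (f x) + A * log x) → A ≤ L := by
    intro A hA
    have h := hA.2 (mem_Ioi.2 one_pos) (mem_Ioi.2 (by norm_num : (0 : ℝ) < 3))
      (by norm_num : (0 : ℝ) ≤ 1 / 2) (by norm_num : (0 : ℝ) ≤ 1 / 2) (by norm_num)
    simp only [smul_eq_mul, hmid, log_one, mul_zero, add_zero] at h
    refine le_of_mul_le_mul_right ?_ hκ
    linarith
  have hlower : ∀ A, ConcaveOn ℝ (Ioi 0) (fun x => log (f x) + A * log x) → L ≤ A := by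
    intro A hA
    have h := hA.2 (mem_Ioi.2 one_pos) (mem_Ioi.2 (by norm_num : (0 : ℝ) < 3))
      (by norm_num : (0 : ℝ) ≤ 1 / 2) (by norm_num : (0 : ℝ) ≤ 1 / 2) (by norm_num)
    simp only [smul_eq_mul, hmid, log_one, mul_zero, add_zero] at h
    refine le_of_mul_le_mul_right ?_ hκ
    linarith
  have hlim : ∀ x : ℝ, Continuous fun A : ℝ => log (f x) + A * log x := fun x => by fun_prop
  have hvex : ConvexOn ℝ (Ioi 0) fun x => log (f x) + L * log x := by
    refine ⟨convex_Ioi 0, fun x hx y hy a b ha hb hab => ?_⟩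
    refine le_of_tendsto_of_tendsto (b := 𝓝[<] L) (((hlim _).tendsto L).mono_left nhdsWithin_le_nhds)
      (((((hlim x).const_smul a).add ((hlim y).const_smul b)).tendsto L).mono_left
        nhdsWithin_le_nhds) ?_
    filter_upwards [self_mem_nhdsWithin] with A hA
    obtain ⟨A', h₁, h₂⟩ := exists_between (mem_Iio.1 hA)
    exact ((hdich A A' h₁).resolve_right fun h => absurd (hlower _ h) (not_le.2 h₂)).2
      hx hy ha hb hab
  have hcave : ConcaveOn ℝ (Ioi 0) fun x => log (f x) + L * log x := by
    refine ⟨convex_Ioi 0, fun x hx y hy a b ha hb hab => ?_⟩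
    refine le_of_tendsto_of_tendsto (b := 𝓝[>] L)
      (((((hlim x).const_smul a).add ((hlim y).const_smul b)).tendsto L).mono_left
        nhdsWithin_le_nhds) (((hlim _).tendsto L).mono_left nhdsWithin_le_nhds) ?_
    filter_upwards [self_mem_nhdsWithin] with A hA
    obtain ⟨A', h₁, h₂⟩ := exists_between (mem_Ioi.1 hA)
    exact ((hdich A' A h₂).resolve_left fun h => absurd (hupper _ h) (not_le.2 h₁)).2
      hx hy ha hb hab
  obtain ⟨β, γ, haff⟩ := exists_affine_of_convexOn_of_concaveOn hvex hcave
  exact exists_gamma_density_of_log_eq hf_pos hf_zero hf_int haff
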